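/- Let k, a, v be integers with 0 ≤ a ≤ k and a + v ≥ 0, and let p be a prime with k + a + v < p. Let D be the (a+v+1) × (a+v+1) matrix over the field 𝔽_p = ℤ/pℤ whose entries are D_{i,j} = C(k, a−i+j) mod p for 0 ≤ i, j ≤ a+v, where C(k,ℓ) is defined to be 0 when ℓ < 0 or ℓ > k. Then det D ≠ 0 in 𝔽_p. -/

import Mathlib

open Finset

/-- Vandermonde's convolution, summed over `Fin (N + 1)` with out-of-range terms set to zero. -/
lemma sum_choose_mul_shifted_choose {R : Type*} [CommRing R] (k a N : ℕ) (i j : Fin (N + 1)) :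
    ∑ s : Fin (N + 1), (Nat.choose i s : R) *
        (if 0 ≤ (a : ℤ) - (s : ℤ) + (j : ℤ) then
          (Nat.choose k ((a : ℤ) - (s : ℤ) + (j : ℤ)).toNat : R) else 0) =
      (Nat.choose (k + i) (a + j) : R) := by
  set f : ℕ → R := fun s => (Nat.choose i s : R) *
    (if 0 ≤ (a : ℤ) - (s : ℤ) + (j : ℤ) then
      (Nat.choose k ((a : ℤ) - (s : ℤ) + (j : ℤ)).toNat : R) else 0) with hf
  have hi := i.isLt
  have hleft : ∑ s ∈ range (N + 1), f s = ∑ s ∈ range (N + 1 + (a + j)), f s := by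
    refine sum_subset (range_subset_range.2 (by omega)) fun s _ hs => ?_
    have hs' : (i : ℕ) < s := by simp at hs; omega
    simp [hf, Nat.choose_eq_zero_of_lt hs']
  have hright : ∑ s ∈ range (a + j + 1), f s = ∑ s ∈ range (N + 1 + (a + j)), f s := by
    refine sum_subset (range_subset_range.2 (by omega)) fun s _ hs => ?_
    have hs' : ¬ 0 ≤ (a : ℤ) - (s : ℤ) + (j : ℤ) := by simp at hs; omega
    simp only [hf, if_neg hs', mul_zero]
  rw [Fin.sum_univ_eq_sum_range f (N + 1), hleft, ← hright, add_comm k, Nat.add_choose_eq,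
    Nat.sum_antidiagonal_eq_sum_range_succ fun s t => Nat.choose i s * Nat.choose k t]
  push_cast
  refine sum_congr rfl fun s hs => ?_
  have hs' : s < a + j + 1 := by simpa using hs
  have h0 : 0 ≤ (a : ℤ) - (s : ℤ) + (j : ℤ) := by omega
  have h1 : ((a : ℤ) - (s : ℤ) + (j : ℤ)).toNat = a + j - s := by omega
  simp only [hf, if_pos h0, h1]

/-- The matrix of binomial coefficients `C(i, j)` is lower unitriangular. -/
lemma det_choose_eq_one {R : Type*} [CommRing R] (n : ℕ) :
    (Matrix.of fun i j : Fin n => (Nat.choose i j : R)).det = 1 := by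
  rw [Matrix.det_of_isLowerTriangular]
  · simp
  · intro i j hij
    have hij' : (i : ℕ) < j := hij
    simp [Nat.choose_eq_zero_of_lt hij']

lemma choose_mul_factorial_mul_factorial_eq_descFactorial {k a : ℕ} (hak : a ≤ k) (i j : ℕ) :
    Nat.choose (k + i) (a + j) * (a + j).factorial * (k - a + i).factorial =
      (k + i).factorial * (k - a + i).descFactorial j := by
  rcases le_or_gt j (k - a + i) with h | h
  · have h1 := Nat.choose_mul_factorial_mul_factorial (show a + j ≤ k + i by omega)
    have h2 := Nat.factorial_mul_descFactorial h
    rw [show k + i - (a + j) = k - a + i - j by omega] at h1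
    rw [← h1, ← h2]
    ring
  · rw [Nat.choose_eq_zero_of_lt (by omega), Nat.descFactorial_eq_zero_iff_lt.2 h]
    simp

lemma det_descFactorial_ne_zero {p : ℕ} [Fact p.Prime] {N : ℕ} (hN : N < p) (m : ℕ) :
    (Matrix.of fun i j : Fin (N + 1) => ((m + i).descFactorial j : ZMod p)).det ≠ 0 := by
  have h := Matrix.det_eval_matrixOfPolynomials_eq_det_vandermonde
    (fun i : Fin (N + 1) => ((m + i : ℕ) : ZMod p))
    (fun j => descPochhammer (ZMod p) j) (fun j => descPochhammer_natDegree _ _)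
    (fun j => monic_descPochhammer _ _)
  simp only [descPochhammer_eval_eq_descFactorial] at h
  rw [← h, Matrix.det_vandermonde_ne_zero_iff]
  intro i j hij
  have hi := i.isLt
  have hj := j.isLt
  have hmod : m + (i : ℕ) ≡ m + j [MOD p] := (ZMod.natCast_eq_natCast_iff _ _ _).1 hij
  exact Fin.ext ((Nat.ModEq.add_left_cancel' m hmod).eq_of_lt_of_lt (by omega) (by omega))

lemma det_choose_add_ne_zero {p : ℕ} [Fact p.Prime] {k a N : ℕ} (hak : a ≤ k) (hkN : k + N < p) :
    (Matrix.of fun i j : Fin (N + 1) => (Nat.choose (k + i) (a + j) : ZMod p)).det ≠ 0 := by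
  intro h0
  have hscaled : (Matrix.of fun i j : Fin (N + 1) => ((k - a + i).factorial : ZMod p) *
      Matrix.of (fun i j : Fin (N + 1) => ((a + j).factorial : ZMod p) *
        Matrix.of (fun i j : Fin (N + 1) => (Nat.choose (k + i) (a + j) : ZMod p)) i j) i j) =
      Matrix.of fun i j : Fin (N + 1) => ((k + i).factorial : ZMod p) *
        Matrix.of (fun i j : Fin (N + 1) => ((k - a + i).descFactorial j : ZMod p)) i j := by
    ext i j
    have h := congrArg (Nat.cast (R := ZMod p))
      (choose_mul_factorial_mul_factorial_eq_descFactorial hak i j)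
    push_cast at h
    simp only [Matrix.of_apply]
    rw [← h]
    ring
  have hdet := congrArg Matrix.det hscaled
  rw [Matrix.det_mul_column, Matrix.det_mul_row, Matrix.det_mul_column, h0, mul_zero, mul_zero,
    eq_comm, mul_eq_zero] at hdet
  refine hdet.elim (fun h => ?_) (det_descFactorial_ne_zero (by omega) _)
  obtain ⟨i, -, hi⟩ := prod_eq_zero_iff.1 h
  rw [ZMod.natCast_eq_zero_iff, (Fact.out : p.Prime).dvd_factorial] at hi
  omega

/-- If `k + a + v < p` for a prime `p`, then the binomial-coefficient matrix `D(k,a,v)`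
has nonzero determinant over `𝔽_p = ℤ/pℤ`. -/
theorem stmt5 (k a : ℕ) (v : ℤ) (p : ℕ) (hp : p.Prime) (hak : a ≤ k) (hav : 0 ≤ (a : ℤ) + v)
    (hkavp : (k : ℤ) + (a : ℤ) + v < (p : ℤ))
    (N : ℕ) (hN : (N : ℤ) = (a : ℤ) + v) :
    Matrix.det (Matrix.of (fun i j : Fin (N + 1) =>
        if 0 ≤ (a : ℤ) - (i : ℤ) + (j : ℤ) then
          ((Nat.choose k ((a : ℤ) - (i : ℤ) + (j : ℤ)).toNat : ZMod p))
        else 0)) ≠ 0 := by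
  have : Fact p.Prime := ⟨hp⟩
  have hne := det_choose_add_ne_zero (p := p) (N := N) hak (by omega)
  rw [← one_mul (Matrix.det _), ← det_choose_eq_one (R := ZMod p) (N + 1), ← Matrix.det_mul]
  convert hne using 2
  ext i j
  rw [Matrix.mul_apply]
  exact sum_choose_mul_shifted_choose k a N i j
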